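/- arXiv:2512.07463 — 6 statements merged into one kernel-verified Lean document; each statement's English description precedes it below -/
import Mathlib

section
/- Let H be a symmetric real n × n matrix, M a real n × n matrix, Q = H M, and G = (Qᵀ + Q) − Mᵀ H M. Let g, g̃ ∈ ℝⁿ and set g⁺ = g − M(g − g̃). Then ‖g − g̃‖²_H − ‖g⁺ − g̃‖²_H = ‖g − g̃‖²_G. -/
open Matrix

/-- Identity (pr3): with `Q = H M`, `G = (Qᵀ + Q) − Mᵀ H M` and
`g⁺ = g − M(g − g̃)`, one has `‖g − g̃‖²_H − ‖g⁺ − g̃‖²_H = ‖g − g̃‖²_G`. -/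
theorem stmt_3 {n : ℕ} (H M : Matrix (Fin n) (Fin n) ℝ) (hH : H.IsSymm)
    (Q G : Matrix (Fin n) (Fin n) ℝ) (hQ : Q = H * M)
    (hG : G = (Qᵀ + Q) - Mᵀ * H * M)
    (g gt gplus : Fin n → ℝ) (hplus : gplus = g - M.mulVec (g - gt)) :
    (g - gt) ⬝ᵥ H.mulVec (g - gt) - (gplus - gt) ⬝ᵥ H.mulVec (gplus - gt) =
      (g - gt) ⬝ᵥ G.mulVec (g - gt) := by
  have hd : gplus - gt = (g - gt) - M.mulVec (g - gt) := by
    rw [hplus]; abel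
  rw [hd, hG, hQ, transpose_mul, hH.eq]
  generalize g - gt = d
  have key (v : Fin n → ℝ) : d ⬝ᵥ Mᵀ.mulVec v = M.mulVec d ⬝ᵥ v := by
    rw [dotProduct_mulVec, vecMul_transpose]
  simp only [sub_mulVec, add_mulVec, mulVec_sub, ← mulVec_mulVec, dotProduct_sub,
    sub_dotProduct, dotProduct_add, key]
  ring
end

section
/- Let H be a symmetric real n × n matrix, M a real n × n matrix, Q = H M, and G = (Qᵀ + Q) − Mᵀ H M. Let g, g̃, g* ∈ ℝⁿ, set g⁺ = g − M(g − g̃), and assume (g* − g̃)ᵀ Q (g − g̃) ≤ 0. Then ‖g⁺ − g*‖²_H ≤ ‖g − g*‖²_H − ‖g − g̃‖²_G. -/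
open Matrix

theorem Matrix.IsSymm.dotProduct_mulVec_comm {ι R : Type*} [Fintype ι] [CommSemiring R]
    {H : Matrix ι ι R} (hH : H.IsSymm) (x y : ι → R) :
    x ⬝ᵥ H *ᵥ y = y ⬝ᵥ H *ᵥ x := by
  rw [dotProduct_mulVec, ← mulVec_transpose, hH.eq, dotProduct_comm]

/-- Proposition B.1 (contraction inequality): with `Q = H M`,
`G = (Qᵀ + Q) − Mᵀ H M`, `g⁺ = g − M(g − g̃)` and the variational-inequality
consequence `(g* − g̃)ᵀ Q (g − g̃) ≤ 0`, one has
`‖g⁺ − g*‖²_H ≤ ‖g − g*‖²_H − ‖g − g̃‖²_G`. -/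
theorem stmt_4 {n : ℕ} (H M : Matrix (Fin n) (Fin n) ℝ) (hH : H.IsSymm)
    (Q G : Matrix (Fin n) (Fin n) ℝ) (hQ : Q = H * M)
    (hG : G = (Qᵀ + Q) - Mᵀ * H * M)
    (g gt gstar gplus : Fin n → ℝ) (hplus : gplus = g - M.mulVec (g - gt))
    (hvi : (gstar - gt) ⬝ᵥ Q.mulVec (g - gt) ≤ 0) :
    (gplus - gstar) ⬝ᵥ H.mulVec (gplus - gstar) ≤
      (g - gstar) ⬝ᵥ H.mulVec (g - gstar) - (g - gt) ⬝ᵥ G.mulVec (g - gt) := by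
  subst hQ hG hplus
  have hsub : g - M *ᵥ (g - gt) - gstar = (g - gstar) - M *ᵥ (g - gt) := by abel
  have hdiff : gstar - gt = (g - gt) - (g - gstar) := by abel
  rw [hdiff] at hvi
  rw [hsub]
  generalize g - gt = d at *
  generalize g - gstar = e at *
  have htrans (x : Fin n → ℝ) : d ⬝ᵥ Mᵀ *ᵥ x = M *ᵥ d ⬝ᵥ x := by
    rw [dotProduct_mulVec, vecMul_transpose]
  simp only [transpose_mul, hH.eq, sub_mulVec, add_mulVec, ← mulVec_mulVec, mulVec_sub,
    sub_dotProduct, dotProduct_sub, dotProduct_add, htrans] at hvi ⊢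
  linarith [hH.dotProduct_mulVec_comm (M *ᵥ d) e, hH.dotProduct_mulVec_comm (M *ᵥ d) d]
end

section
/- Let H be a symmetric positive semidefinite real n × n matrix, M a real n × n matrix, Q = H M, and suppose G = (Qᵀ + Q) − Mᵀ H M is positive semidefinite. Let g, g̃, g', g̃' ∈ ℝⁿ with g' = g − M(g − g̃) and g'' = g' − M(g' − g̃'). If (g̃ − g̃')ᵀ Q [(g − g̃) − (g' − g̃')] ≥ 0, then ‖g' − g''‖²_H ≤ ‖g − g'‖²_H. -/
open Matrix

/-- The quadratic form of `(Qᵀ + Q) - Mᵀ H M` with `Q = H M`. -/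
theorem dotProduct_correction_mulVec {n : ℕ} (H M : Matrix (Fin n) (Fin n) ℝ)
    (d : Fin n → ℝ) :
    d ⬝ᵥ (((H * M)ᵀ + H * M) - Mᵀ * H * M).mulVec d =
      2 * (d ⬝ᵥ H.mulVec (M.mulVec d)) - M.mulVec d ⬝ᵥ H.mulVec (M.mulVec d) := by
  have h₁ : d ⬝ᵥ (H * M)ᵀ.mulVec d = d ⬝ᵥ (H * M).mulVec d := by
    rw [mulVec_transpose, dotProduct_comm, dotProduct_mulVec]
  have h₂ : d ⬝ᵥ (Mᵀ * H * M).mulVec d = M.mulVec d ⬝ᵥ H.mulVec (M.mulVec d) := by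
    rw [← mulVec_mulVec, ← mulVec_mulVec, dotProduct_mulVec, vecMul_transpose]
  rw [sub_mulVec, add_mulVec, dotProduct_sub, dotProduct_add, h₁, h₂, ← mulVec_mulVec]
  ring

/-- Polarization: `‖x‖²_H - ‖y‖²_H = 2 xᵀ H (x - y) - ‖x - y‖²_H` for symmetric `H`. -/
theorem dotProduct_mulVec_self_sub {n : ℕ} {H : Matrix (Fin n) (Fin n) ℝ}
    (hH : Hᵀ = H) (x y : Fin n → ℝ) :
    x ⬝ᵥ H.mulVec x - y ⬝ᵥ H.mulVec y =
      2 * (x ⬝ᵥ H.mulVec (x - y)) - (x - y) ⬝ᵥ H.mulVec (x - y) := by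
  have h : y ⬝ᵥ H.mulVec x = x ⬝ᵥ H.mulVec y := by
    rw [dotProduct_mulVec, ← mulVec_transpose, hH, dotProduct_comm]
  simp only [mulVec_sub, dotProduct_sub, sub_dotProduct, h]
  ring

/-- Proposition B.2: monotone non-increase of successive iterate differences
for the prediction–correction scheme. -/
theorem stmt_5 {n : ℕ} (H M : Matrix (Fin n) (Fin n) ℝ)
    (hH : H.PosSemidef)
    (Q G : Matrix (Fin n) (Fin n) ℝ) (hQ : Q = H * M)
    (hG : G = (Qᵀ + Q) - Mᵀ * H * M) (hGpsd : G.PosSemidef)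
    (g gt g' gt' g'' : Fin n → ℝ)
    (hg' : g' = g - M.mulVec (g - gt))
    (hg'' : g'' = g' - M.mulVec (g' - gt'))
    (hcr3 : 0 ≤ (gt - gt') ⬝ᵥ Q.mulVec ((g - gt) - (g' - gt'))) :
    (g' - g'') ⬝ᵥ H.mulVec (g' - g'') ≤ (g - g') ⬝ᵥ H.mulVec (g - g') := by
  have hsymm : Hᵀ = H := by simpa [IsHermitian] using hH.isHermitian
  set d := (g - gt) - (g' - gt') with hd
  have hMd : (g - g') - (g' - g'') = M.mulVec d := by
    have h₁ : g - g' = M.mulVec (g - gt) := by rw [hg', sub_sub_cancel]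
    have h₂ : g' - g'' = M.mulVec (g' - gt') := by rw [hg'', sub_sub_cancel]
    rw [h₁, h₂, hd, mulVec_sub M (g - gt)]
  have hx : g - g' = d + (gt - gt') := by rw [hd]; abel
  have hpos : 0 ≤ d ⬝ᵥ G.mulVec d := by
    simpa using hGpsd.dotProduct_mulVec_nonneg d
  rw [hG, hQ, dotProduct_correction_mulVec] at hpos
  rw [hQ, ← mulVec_mulVec] at hcr3
  have key := dotProduct_mulVec_self_sub hsymm (g - g') (g' - g'')
  have hsplit : (g - g') ⬝ᵥ H.mulVec (M.mulVec d) =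
      d ⬝ᵥ H.mulVec (M.mulVec d) + (gt - gt') ⬝ᵥ H.mulVec (M.mulVec d) := by
    rw [hx, add_dotProduct]
  rw [hMd, hsplit] at key
  linarith
end

section
/- Let B be a real m × q matrix and C a real m × r matrix such that BᵀB and CᵀC are positive definite. Then the block matrix [[BᵀB, BᵀC], [CᵀB, CᵀC + CᵀB(BᵀB)⁻¹BᵀC]] of size (q + r) × (q + r) is positive definite. Consequently, for μ > 0 and ν ∈ (0,1), the matrix H = [[(μ/ν)BᵀB, (μ/ν)BᵀC, 0], [(μ/ν)CᵀB, (μ/ν)(CᵀC + CᵀB(BᵀB)⁻¹BᵀC), 0], [0, 0, (1/μ)I_m]] is positive definite. -/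
open Matrix

/-- A Hermitian block matrix is positive definite as soon as its upper left block and the
corresponding Schur complement are. -/
theorem Matrix.PosDef.fromBlocks_of_schur {n p : Type*} [Fintype n] [Fintype p] [DecidableEq n]
    {A : Matrix n n ℝ} (hA : A.PosDef) (B : Matrix n p ℝ) (D : Matrix p p ℝ)
    (hS : (D - Bᴴ * A⁻¹ * B).PosDef) : (fromBlocks A B Bᴴ D).PosDef := by
  have : Invertible A := hA.isUnit.invertible
  refine .of_dotProduct_mulVec_pos ((IsHermitian.fromBlocks₁₁ _ _ hA.1).2 hS.1) fun x hx => ?_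
  rw [dotProduct_mulVec, ← Sum.elim_comp_inl_inr x, schur_complement_eq₁₁ B D _ _ hA.1]
  simp only [← dotProduct_mulVec]
  by_cases hy : x ∘ Sum.inr = 0
  · have hx' : x ∘ Sum.inl ≠ 0 := fun h => hx <| by
      rw [← Sum.elim_comp_inl_inr x, h, hy, Sum.elim_zero_zero]
    simpa [hy] using hA.dotProduct_mulVec_pos hx'
  · exact add_pos_of_nonneg_of_pos (hA.posSemidef.dotProduct_mulVec_nonneg _)
      (hS.dotProduct_mulVec_pos hy)

/-- Proposition: the matrix `[[BᵀB, BᵀC], [CᵀB, CᵀC + CᵀB(BᵀB)⁻¹BᵀC]]` is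
positive definite, and consequently the weighting matrix `H` of the Gaussian
back-substitution scheme is positive definite for `μ > 0`, `ν ∈ (0,1)`. -/
theorem stmt_11 {m q r : ℕ}
    (B : Matrix (Fin m) (Fin q) ℝ) (C : Matrix (Fin m) (Fin r) ℝ)
    (hB : (Bᵀ * B).PosDef) (hC : (Cᵀ * C).PosDef)
    (μ ν : ℝ) (hμ : 0 < μ) (hν : ν ∈ Set.Ioo (0 : ℝ) 1)
    (H : Matrix ((Fin q ⊕ Fin r) ⊕ Fin m) ((Fin q ⊕ Fin r) ⊕ Fin m) ℝ)
    (hH : H = fromBlocks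
      (fromBlocks ((μ / ν) • (Bᵀ * B)) ((μ / ν) • (Bᵀ * C))
        ((μ / ν) • (Cᵀ * B))
        ((μ / ν) • (Cᵀ * C + Cᵀ * B * (Bᵀ * B)⁻¹ * Bᵀ * C))) 0
      0 ((1 / μ) • (1 : Matrix (Fin m) (Fin m) ℝ))) :
    (fromBlocks (Bᵀ * B) (Bᵀ * C) (Cᵀ * B)
        (Cᵀ * C + Cᵀ * B * (Bᵀ * B)⁻¹ * Bᵀ * C)).PosDef ∧ H.PosDef := by
  have hM : (fromBlocks (Bᵀ * B) (Bᵀ * C) (Cᵀ * B)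
      (Cᵀ * C + Cᵀ * B * (Bᵀ * B)⁻¹ * Bᵀ * C)).PosDef := by
    have hCB : (Bᵀ * C)ᴴ = Cᵀ * B := by
      rw [conjTranspose_eq_transpose_of_trivial, transpose_mul, transpose_transpose]
    have h := hB.fromBlocks_of_schur (Bᵀ * C) (Cᵀ * C + Cᵀ * B * (Bᵀ * B)⁻¹ * Bᵀ * C) (by
      rw [hCB, ← Matrix.mul_assoc, add_sub_cancel_right]
      exact hC)
    rwa [hCB] at h
  refine ⟨hM, ?_⟩
  have hI : ((1 / μ) • (1 : Matrix (Fin m) (Fin m) ℝ)).PosDef :=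
    PosDef.one.smul (one_div_pos.2 hμ)
  have h := (hM.smul (div_pos hμ hν.1)).fromBlocks_of_schur 0
    ((1 / μ) • (1 : Matrix (Fin m) (Fin m) ℝ)) (by simpa using hI)
  rwa [conjTranspose_zero, fromBlocks_smul, ← hH] at h
end

section
/- Let λ > 0, s > 0, d ≥ 1, and x ∈ ℝᵈ. Then the function θ ↦ λ‖θ‖₂ + (s/2)‖θ − x‖₂² has a unique minimizer over ℝᵈ: it equals the zero vector if ‖x‖₂ ≤ λ/s, and equals (1 − λ/(s‖x‖₂)) · x if ‖x‖₂ > λ/s; equivalently it is (x/‖x‖₂) · max(‖x‖₂ − λ/s, 0) whenever x ≠ 0. -/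
/-- Strong convexity at a stationary point: if `s • (x - p)` is a subgradient of `lam * ‖·‖` at `p`,
then the proximal objective grows at least quadratically away from `p`. -/
theorem prox_norm_quadratic_growth {E : Type*} [NormedAddCommGroup E] [InnerProductSpace ℝ E]
    {lam s : ℝ} {x p : E} (hnorm : s * ‖x - p‖ ≤ lam) (hs : 0 ≤ s)
    (hinner : s * inner ℝ (x - p) p = lam * ‖p‖) (θ : E) :
    lam * ‖p‖ + s / 2 * ‖p - x‖ ^ 2 + s / 2 * ‖θ - p‖ ^ 2 ≤
      lam * ‖θ‖ + s / 2 * ‖θ - x‖ ^ 2 := by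
  have hθ : s * inner ℝ (x - p) θ ≤ lam * ‖θ‖ :=
    calc s * inner ℝ (x - p) θ ≤ s * (‖x - p‖ * ‖θ‖) := by
          gcongr
          exact real_inner_le_norm _ _
      _ = s * ‖x - p‖ * ‖θ‖ := by ring
      _ ≤ lam * ‖θ‖ := by gcongr
  have hsq : ‖θ - x‖ ^ 2 =
      ‖θ - p‖ ^ 2 - 2 * (inner ℝ (x - p) θ - inner ℝ (x - p) p) + ‖p - x‖ ^ 2 := by
    rw [← inner_sub_right, real_inner_comm, norm_sub_rev p x, ← norm_sub_sq_real]
    congr 2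
    abel
  rw [hsq]
  linarith

/-- Proximal operator of the ℓ₂ norm (Yuan–Lin): the function
`θ ↦ λ‖θ‖₂ + (s/2)‖θ − x‖₂²` has the unique minimizer `0` if `‖x‖₂ ≤ λ/s`
and `(1 − λ/(s‖x‖₂)) x` otherwise; equivalently
`(x/‖x‖₂) · max(‖x‖₂ − λ/s, 0)` whenever `x ≠ 0`. -/
theorem stmt_14 (lam s : ℝ) (hlam : 0 < lam) (hs : 0 < s)
    (d : ℕ) (hd : 1 ≤ d) (x : EuclideanSpace ℝ (Fin d))
    (f : EuclideanSpace ℝ (Fin d) → ℝ)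
    (hf : f = fun θ => lam * ‖θ‖ + (s / 2) * ‖θ - x‖ ^ 2)
    (θstar : EuclideanSpace ℝ (Fin d))
    (hθstar : θstar = if ‖x‖ ≤ lam / s then 0 else (1 - lam / (s * ‖x‖)) • x) :
    (∀ θ : EuclideanSpace ℝ (Fin d), f θstar ≤ f θ) ∧
      (∀ θ : EuclideanSpace ℝ (Fin d), (∀ γ, f θ ≤ f γ) → θ = θstar) ∧
      (x ≠ 0 → θstar = (max (‖x‖ - lam / s) 0 / ‖x‖) • x) := by
  have hstat : s * ‖x - θstar‖ ≤ lam ∧ s * inner ℝ (x - θstar) θstar = lam * ‖θstar‖ := by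
    rw [hθstar]
    split_ifs with h
    · simpa [mul_comm] using (le_div_iff₀ hs).1 h
    · have hx : 0 < ‖x‖ := (div_pos hlam hs).trans (not_le.1 h)
      have hsx : lam < s * ‖x‖ := by
        rw [mul_comm]
        exact (div_lt_iff₀ hs).1 (not_le.1 h)
      have hc : 0 ≤ 1 - lam / (s * ‖x‖) :=
        sub_nonneg.2 ((div_le_one (by positivity)).2 hsx.le)
      have hsub : x - (1 - lam / (s * ‖x‖)) • x = (lam / (s * ‖x‖)) • x := by module
      rw [hsub, norm_smul, norm_smul, Real.norm_of_nonneg hc,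
        Real.norm_of_nonneg (by positivity), real_inner_smul_left, real_inner_smul_right,
        real_inner_self_eq_norm_sq]
      constructor
      · apply le_of_eq
        field_simp
      · field_simp
  have hgrowth := prox_norm_quadratic_growth hstat.1 hs.le hstat.2
  subst hf
  refine ⟨fun θ => ?_, fun θ hθ => ?_, fun hx => ?_⟩
  · have : 0 ≤ s / 2 * ‖θ - θstar‖ ^ 2 := by positivity
    linarith [hgrowth θ]
  · have hle : s / 2 * ‖θ - θstar‖ ^ 2 ≤ 0 := by linarith [hgrowth θ, hθ θstar]
    have hsq : ‖θ - θstar‖ ^ 2 ≤ 0 := nonpos_of_mul_nonpos_right hle (by positivity)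
    exact sub_eq_zero.1 (norm_eq_zero.1 (pow_eq_zero_iff two_ne_zero |>.1
      (hsq.antisymm (sq_nonneg _))))
  · have hx' : ‖x‖ ≠ 0 := norm_ne_zero_iff.2 hx
    rw [hθstar]
    split_ifs with h
    · simp [max_eq_right (sub_nonpos.2 h)]
    · rw [max_eq_left (sub_nonneg.2 (not_le.1 h).le)]
      congr 1
      field_simp
end

section
/- Let n > 0, μ > 0, τ ∈ (0, 1], and ζ ∈ ℝ. Define the pinball loss L_τ(ξ) = ξ for ξ ≥ 0 and L_τ(ξ) = −τξ for ξ < 0. Then the function ξ ↦ (1/n)·L_τ(ξ) + (μ/2)(ξ − ζ)² has a unique minimizer over ℝ, equal to max{ζ − 1/(nμ), min(0, ζ + τ/(nμ))}. -/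
/-- The point `s = max (ζ - c) (min 0 (ζ + τ * c))` satisfies the variational inequality
`ζ - s ∈ c • ∂L_τ(s)` for the pinball loss `L_τ`. -/
lemma pinball_variational_ineq {c τ : ℝ} (hc : 0 < c) (hτ : 0 < τ) (ζ s ξ : ℝ)
    (hs : s = max (ζ - c) (min 0 (ζ + τ * c))) :
    c * (if 0 ≤ s then s else -τ * s) + (ζ - s) * (ξ - s) ≤
      c * (if 0 ≤ ξ then ξ else -τ * ξ) := by
  have hτc : 0 < τ * c := mul_pos hτ hc
  rcases lt_or_ge c ζ with h | h
  · have hs' : s = ζ - c := by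
      rw [hs, min_eq_left (by linarith), max_eq_left (by linarith)]
    rw [if_pos (by linarith : 0 ≤ s)]
    split_ifs <;> subst hs' <;> nlinarith
  · rcases lt_or_ge ζ (-(τ * c)) with h' | h'
    · have hs' : s = ζ + τ * c := by
        rw [hs, min_eq_right (by linarith), max_eq_right (by linarith)]
      rw [if_neg (by linarith : ¬ 0 ≤ s)]
      split_ifs <;> subst hs' <;> nlinarith
    · have hs' : s = 0 := by
        rw [hs, min_eq_left (by linarith), max_eq_right (by linarith)]
      rw [if_pos hs'.ge, hs']
      split_ifs <;> nlinarith

/-- Closed-form proximal solution for the pinball loss (Table 4):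
with `L_τ(ξ) = ξ` for `ξ ≥ 0` and `L_τ(ξ) = −τξ` for `ξ < 0`, the function
`ξ ↦ (1/n)·L_τ(ξ) + (μ/2)(ξ − ζ)²` has the unique minimizer
`max{ζ − 1/(nμ), min(0, ζ + τ/(nμ))}`. -/
theorem stmt_17 (n μ τ ζ : ℝ) (hn : 0 < n) (hμ : 0 < μ)
    (hτ : τ ∈ Set.Ioc (0 : ℝ) 1)
    (L : ℝ → ℝ) (hL : L = fun ξ => if 0 ≤ ξ then ξ else -τ * ξ)
    (f : ℝ → ℝ) (hf : f = fun ξ => (1 / n) * L ξ + (μ / 2) * (ξ - ζ) ^ 2)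
    (ξstar : ℝ) (hξstar : ξstar = max (ζ - 1 / (n * μ)) (min 0 (ζ + τ / (n * μ)))) :
    (∀ ξ : ℝ, f ξstar ≤ f ξ) ∧ (∀ ξ : ℝ, (∀ γ, f ξ ≤ f γ) → ξ = ξstar) := by
  have key : ∀ ξ, f ξstar + μ / 2 * (ξ - ξstar) ^ 2 ≤ f ξ := by
    intro ξ
    have hvar := pinball_variational_ineq (c := 1 / (n * μ)) (by positivity) hτ.1 ζ ξstar ξ
      (by rw [hξstar, mul_one_div])
    have hscale : 1 / n = μ * (1 / (n * μ)) := by field_simp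
    have hmul := mul_le_mul_of_nonneg_left hvar hμ.le
    simp only [hf, hL]
    rw [hscale]
    linarith
  refine ⟨fun ξ => ?_, fun ξ hξ => ?_⟩
  · have : 0 ≤ μ / 2 * (ξ - ξstar) ^ 2 := by positivity
    linarith [key ξ]
  · have hle : μ / 2 * (ξ - ξstar) ^ 2 ≤ 0 := by linarith [key ξ, hξ ξstar]
    have hsq : (ξ - ξstar) ^ 2 = 0 :=
      le_antisymm (nonpos_of_mul_nonpos_right hle (half_pos hμ)) (sq_nonneg _)
    exact sub_eq_zero.mp (pow_eq_zero_iff two_ne_zero |>.mp hsq)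
end
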